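/- arXiv:0906.2753 — 4 statements merged into one kernel-verified Lean document; each statement's English description precedes it below -/
import Mathlib

section
/- If P ⊆ ℝ² is closed and uncountable, then there is a continuously differentiable function F : ℝ → ℝ and a Cantor set Q ⊆ P such that Q is contained in the graph of F (after a suitable rotation of coordinates). -/
namespace CArc
open Set Filter Topology

section geom
variable {E : Type*} [MetricSpace E]

/-- The pair `(p, q)` is ordered by `X` and has slope in `(a, b)`. -/
def Pr (X Y : E → ℝ) (a b : ℝ) (p q : E) : Prop :=
  X p < X q ∧ a * (X q - X p) < Y q - Y p ∧ Y q - Y p < b * (X q - X p)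

/-- Slopes in `(a, b)` occur in every open piece of `P ∩ U`. -/
def Good (X Y : E → ℝ) (P U : Set E) (a b : ℝ) : Prop :=
  ∀ V ⊆ U, IsOpen V → (V ∩ P).Nonempty → ∃ p ∈ V ∩ P, ∃ q ∈ V ∩ P, Pr X Y a b p q

variable {X Y : E → ℝ} {P : Set E}

lemma Good.mono {U U' : Set E} {a b : ℝ} (h : Good X Y P U a b) (hU : U' ⊆ U) :
    Good X Y P U' a b := fun V hV => h V (hV.trans hU)

lemma Good.third {U : Set E} {a b : ℝ} (hU : IsOpen U) (hne : (U ∩ P).Nonempty)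
    (h : Good X Y P U a b) :
    ∃ U' ⊆ U, IsOpen U' ∧ (U' ∩ P).Nonempty ∧ ∃ a' b', a ≤ a' ∧ b' ≤ b ∧
      b' - a' = 2 / 3 * (b - a) ∧ Good X Y P U' a' b' := by
  have hab : a < b := by
    obtain ⟨p, _, q, _, h1, h2, h3⟩ := h U le_rfl hU hne
    by_contra hc
    push Not at hc
    nlinarith
  by_cases hc : Good X Y P U a (a + 2 / 3 * (b - a))
  · exact ⟨U, le_rfl, hU, hne, a, _, le_rfl, by linarith, by ring, hc⟩
  · simp only [Good] at hc
    push Not at hc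
    obtain ⟨V, hVU, hV, hVne, hno⟩ := hc
    refine ⟨V, hVU, hV, hVne, a + (b - a) / 3, b, by linarith, le_rfl, by ring, ?_⟩
    intro W hWV hW hWne
    obtain ⟨p, hp, q, hq, h1, h2, h3⟩ := h W (hWV.trans hVU) hW hWne
    refine ⟨p, hp, q, hq, h1, ?_, h3⟩
    have := hno p ⟨hWV hp.1, hp.2⟩ q ⟨hWV hq.1, hq.2⟩
    by_contra hlt
    push Not at hlt
    refine this ⟨h1, h2, lt_of_le_of_lt hlt ?_⟩
    nlinarith

lemma Good.refine {U : Set E} {a b : ℝ} (hU : IsOpen U) (hne : (U ∩ P).Nonempty)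
    (h : Good X Y P U a b) {ε : ℝ} (hε : 0 < ε) :
    ∃ U' ⊆ U, IsOpen U' ∧ (U' ∩ P).Nonempty ∧ ∃ a' b', a ≤ a' ∧ b' ≤ b ∧
      b' - a' ≤ ε ∧ Good X Y P U' a' b' := by
  have key : ∀ n : ℕ, ∃ U' ⊆ U, IsOpen U' ∧ (U' ∩ P).Nonempty ∧ ∃ a' b', a ≤ a' ∧ b' ≤ b ∧
      b' - a' = (2 / 3) ^ n * (b - a) ∧ Good X Y P U' a' b' := by
    intro n
    induction n with
    | zero => exact ⟨U, le_rfl, hU, hne, a, b, le_rfl, le_rfl, by simp, h⟩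
    | succ n ih =>
      obtain ⟨U1, h1, h2, h3, a1, b1, h4, h5, h6, h7⟩ := ih
      obtain ⟨U2, k1, k2, k3, a2, b2, k4, k5, k6, k7⟩ := h7.third h2 h3
      exact ⟨U2, k1.trans h1, k2, k3, a2, b2, h4.trans k4, k5.trans h5,
        by rw [k6, h6]; ring, k7⟩
  have ht : Tendsto (fun n : ℕ => ((2 : ℝ) / 3) ^ n * (b - a)) atTop (𝓝 (0 * (b - a))) :=
    (tendsto_pow_atTop_nhds_zero_of_lt_one (by norm_num) (by norm_num)).mul_const _
  rw [zero_mul] at ht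
  obtain ⟨n, hn⟩ := (ht.eventually (gt_mem_nhds hε)).exists
  obtain ⟨U1, h1, h2, h3, a1, b1, h4, h5, h6, h7⟩ := key n
  exact ⟨U1, h1, h2, h3, a1, b1, h4, h5, by rw [h6]; exact hn.le, h7⟩

/-- A node of the fusion tree. -/
structure Node (X Y : E → ℝ) (P : Set E) where
  q : E
  r : ℝ
  a : ℝ
  b : ℝ
  hq : q ∈ P
  hr : 0 < r
  good : Good X Y P (Metric.ball q r) a b

/-- What it means for `M` to be the two children of `N`. -/
structure Child (N : Node X Y P) (ε : ℝ) (M : Bool → Node X Y P) : Prop where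
  ha : ∀ c, (M c).a = (M false).a
  hb : ∀ c, (M c).b = (M false).b
  hr : ∀ c, (M c).r = (M false).r
  ha' : N.a ≤ (M false).a
  hb' : (M false).b ≤ N.b
  hε : (M false).b - (M false).a ≤ ε
  hr2 : (M false).r ≤ N.r / 2
  sub : ∀ c, Metric.closedBall (M c).q (M c).r ⊆ Metric.closedBall N.q N.r
  sep : ∀ p ∈ Metric.closedBall (M false).q (M false).r,
    ∀ p' ∈ Metric.closedBall (M true).q (M true).r,
      8 * (M false).r ≤ X p' - X p ∧ Pr X Y (M false).a (M false).b p p'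

lemma exists_child (hX : LipschitzWith 1 X) (hY : LipschitzWith 1 Y) (N : Node X Y P) {ε : ℝ}
    (hε : 0 < ε) : ∃ M, Child N ε M := by
  obtain ⟨U, hUN, hU, hne, a, b, ha, hb, hab, hG⟩ :=
    N.good.refine Metric.isOpen_ball ⟨N.q, Metric.mem_ball_self N.hr, N.hq⟩ hε
  obtain ⟨p, hp, q, hq, hpq⟩ := hG U le_rfl hU hne
  have hXc := hX.continuous
  have hYc := hY.continuous
  have hopen : IsOpen {w : E × E | Pr X Y a b w.1 w.2} := by
    unfold Pr
    rw [Set.ofPred_and, Set.ofPred_and]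
    refine IsOpen.inter ?_ (IsOpen.inter ?_ ?_)
    all_goals exact isOpen_lt (by fun_prop) (by fun_prop)
  obtain ⟨ρ, hρ, hball⟩ := Metric.isOpen_iff.1 hopen (p, q) hpq
  obtain ⟨ρ1, hρ1, hb1⟩ := Metric.isOpen_iff.1 hU p hp.1
  obtain ⟨ρ2, hρ2, hb2⟩ := Metric.isOpen_iff.1 hU q hq.1
  have hd : 0 < X q - X p := sub_pos.2 hpq.1
  obtain ⟨r, hr0, hr⟩ : ∃ r > 0, r < min (min ρ (min ρ1 ρ2)) (min (N.r / 2) ((X q - X p) / 10)) :=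
    exists_between (by have := N.hr; positivity)
  simp only [lt_min_iff] at hr
  obtain ⟨⟨r1, r2, r3⟩, r4, r5⟩ := hr
  have s1 : Metric.closedBall p r ⊆ U := (Metric.closedBall_subset_ball r2).trans hb1
  have s2 : Metric.closedBall q r ⊆ U := (Metric.closedBall_subset_ball r3).trans hb2
  have hUN' := hUN.trans Metric.ball_subset_closedBall
  refine ⟨fun c => bif c then ⟨q, r, a, b, hq.2, hr0,
      hG.mono (Metric.ball_subset_closedBall.trans s2)⟩
    else ⟨p, r, a, b, hp.2, hr0, hG.mono (Metric.ball_subset_closedBall.trans s1)⟩, ?_⟩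
  refine ⟨by rintro (_|_) <;> rfl, by rintro (_|_) <;> rfl, by rintro (_|_) <;> rfl,
    ha, hb, hab, r4.le, ?_, ?_⟩
  · rintro (_|_)
    · exact s1.trans hUN'
    · exact s2.trans hUN'
  · intro u hu v hv
    simp only [cond_false, cond_true] at hu hv ⊢
    refine ⟨?_, ?_⟩
    · have e1 := hX.dist_le_mul u p
      have e2 := hX.dist_le_mul v q
      rw [Metric.mem_closedBall] at hu hv
      simp only [NNReal.coe_one, one_mul, Real.dist_eq] at e1 e2
      have := abs_le.1 (e1.trans hu)
      have := abs_le.1 (e2.trans hv)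
      linarith
    · have : (u, v) ∈ Metric.ball (p, q) ρ := by
        rw [Metric.mem_ball, Prod.dist_eq, max_lt_iff]
        exact ⟨lt_of_le_of_lt hu r1, lt_of_le_of_lt hv r1⟩
      exact hball this

open PiNat in
lemma fusion [CompleteSpace E] (hX : LipschitzWith 1 X) (hY : LipschitzWith 1 Y)
    (hP : IsClosed P) {U : Set E} (hU : IsOpen U) (hUP : (U ∩ P).Nonempty)
    {a b : ℝ}
    (hG : Good X Y P U a b) (ε : List Bool → ℝ) (hε : ∀ s, 0 < ε s) :
    ∃ (f : (ℕ → Bool) → E) (r A B : List Bool → ℝ),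
      (∀ z, f z ∈ P) ∧ (∀ t, 0 < r t) ∧ (∀ t, r t ≤ (1 / 2) ^ t.length) ∧
      (∀ t z z', res z t.length = t → res z' t.length = t → dist (f z) (f z') ≤ 2 * r t) ∧
      (∀ t z z', res z t.length = t → res z' t.length ≠ t → 4 * r t ≤ |X (f z) - X (f z')|) ∧
      (∀ t z z', res z (t.length + 1) = false :: t → res z' (t.length + 1) = true :: t →
        Pr X Y (A t) (B t) (f z) (f z')) ∧
      (∀ t c, A t ≤ A (c :: t)) ∧ (∀ t c, B (c :: t) ≤ B t) ∧ (∀ t, B t - A t ≤ ε t) := by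
  obtain ⟨q0, hq0U, hq0⟩ := hUP
  obtain ⟨ρ, hρ, hρU⟩ := Metric.isOpen_iff.1 hU q0 hq0U
  let N0 : Node X Y P := ⟨q0, min ρ 1, a, b, hq0, by positivity,
    hG.mono ((Metric.ball_subset_ball (min_le_left _ _)).trans hρU)⟩
  choose! M hM using fun (N : Node X Y P) (ε : ℝ) (h : 0 < ε) => exists_child hX hY N h
  let T : List Bool → Node X Y P := fun l => List.rec N0 (fun c t N => M N (ε t) c) l
  have T0 : T [] = N0 := rfl
  have TS : ∀ c t, T (c :: t) = M (T t) (ε t) c := fun c t => rfl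
  have hC : ∀ t, Child (T t) (ε t) (fun c => T (c :: t)) := fun t => hM _ _ (hε t)
  have hrS : ∀ c t, (T (c :: t)).r ≤ (T t).r / 2 := fun c t => by
    rw [(hC t).hr c]; exact (hC t).hr2
  have hrl : ∀ t, (T t).r ≤ (1 / 2) ^ t.length := by
    intro t
    induction t with
    | nil => rw [T0]; simp [N0]
    | cons c t ih =>
      have := hrS c t
      rw [List.length_cons, pow_succ]
      linarith
  -- the branches
  have hsub : ∀ z : ℕ → Bool, ∀ n k, Metric.closedBall (T (res z (n + k))).q (T (res z (n + k))).r ⊆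
      Metric.closedBall (T (res z n)).q (T (res z n)).r := by
    intro z n k
    induction k with
    | zero => exact le_rfl
    | succ k ih =>
      rw [← add_assoc]
      exact ((hC (res z (n + k))).sub (z (n + k))).trans ih
  have hmem : ∀ z : ℕ → Bool, ∀ n k, (T (res z (n + k))).q ∈
      Metric.closedBall (T (res z n)).q (T (res z n)).r := fun z n k =>
    hsub z n k (Metric.mem_closedBall_self (T _).hr.le)
  have hlim : ∀ z : ℕ → Bool, ∃ x, Tendsto (fun n => (T (res z n)).q) atTop (𝓝 x) := by
    intro z
    apply cauchySeq_tendsto_of_complete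
    apply cauchySeq_of_le_geometric_two (C := 2)
    intro n
    have h1 := hmem z n 1
    have h2 := hrl (res z n)
    rw [res_length] at h2
    rw [Metric.mem_closedBall, dist_comm] at h1
    calc _ ≤ _ := h1
      _ ≤ _ := h2
      _ = _ := by rw [div_pow, one_pow]; norm_num
  choose f hf using hlim
  have hfm : ∀ z n, f z ∈ Metric.closedBall (T (res z n)).q (T (res z n)).r := by
    intro z n
    refine Metric.isClosed_closedBall.mem_of_tendsto (hf z) ?_
    filter_upwards [eventually_ge_atTop n] with m hm
    obtain ⟨k, rfl⟩ := Nat.exists_eq_add_of_le hm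
    exact hmem z n k
  have hfm' : ∀ z t, res z t.length = t → f z ∈ Metric.closedBall (T t).q (T t).r := by
    intro z t h
    have := hfm z t.length
    rwa [h] at this
  refine ⟨f, fun t => (T t).r, fun t => (T (false :: t)).a, fun t => (T (false :: t)).b,
    ?_, ?_, hrl, ?_, ?_, ?_, ?_, ?_, ?_⟩
  · intro z
    exact hP.mem_of_tendsto (hf z) (Eventually.of_forall fun n => (T _).hq)
  · exact fun t => (T t).hr
  · intro t z z' h h'
    have h1 := hfm' z t h
    have h2 := hfm' z' t h'
    rw [Metric.mem_closedBall] at h1 h2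
    have := dist_triangle_right (f z) (f z') (T t).q
    linarith
  · intro t
    induction t with
    | nil => intro z z' _ h; simp at h
    | cons c t ih =>
      intro z z' h h'
      have hz := hfm' z _ h
      have hpos := (T (c :: t)).hr
      rw [List.length_cons, res_succ, List.cons.injEq] at h
      by_cases ht : res z' t.length = t
      · have hc : z' t.length = !c := by
          have : z' t.length ≠ c := by
            intro hh; apply h'
            rw [List.length_cons, res_succ, ht, hh]
          revert this
          cases c <;> cases z' t.length <;> simp
        have hz' := hfm' z' ((!c) :: t) (by rw [List.length_cons, res_succ, ht, hc])
        have hr := (hC t).hr c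
        cases c
        · have := ((hC t).sep _ hz _ hz').1
          rw [abs_sub_comm]
          exact le_trans (by linarith) (le_abs_self _)
        · have := ((hC t).sep _ hz' _ hz).1
          exact le_trans (by linarith) (le_abs_self _)
      · have := ih z z' h.2 ht
        have := hrS c t
        linarith
  · intro t z z' h h'
    exact ((hC t).sep _ (hfm' z (false :: t) h) _ (hfm' z' (true :: t) h')).2
  · intro t c
    have h1 := (hC t).ha c
    have h2 := (hC (c :: t)).ha'
    simp only at h1 h2 ⊢
    linarith
  · intro t c
    have h1 := (hC t).hb c
    have h2 := (hC (c :: t)).hb'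
    simp only at h1 h2 ⊢
    linarith
  · intro t
    exact (hC t).hε

end geom

lemma exists_theta : ∃ (θ : ℝ → ℝ) (C : ℝ), 0 < C ∧ ContDiff ℝ 1 θ ∧ (∀ u, |u| ≤ 1 → θ u = u) ∧
    (∀ u, 2 ≤ |u| → θ u = 0) ∧ (∀ u, |θ u| ≤ C) ∧ (∀ u, |deriv θ u| ≤ C) := by
  let χ : ContDiffBump (0 : ℝ) := ⟨1, 2, one_pos, one_lt_two⟩
  have hθ : ContDiff ℝ 1 (fun u : ℝ => u * χ u) := contDiff_id.mul χ.contDiff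
  have hcs : HasCompactSupport (fun u : ℝ => u * χ u) := χ.hasCompactSupport.mul_left
  obtain ⟨C1, h1⟩ := hcs.exists_bound_of_continuous hθ.continuous
  obtain ⟨C2, h2⟩ := hcs.deriv.exists_bound_of_continuous (hθ.continuous_deriv le_rfl)
  refine ⟨fun u => u * χ u, max 1 (max C1 C2), by positivity, hθ, ?_, ?_, ?_, ?_⟩
  · intro u hu
    have : χ u = 1 := χ.one_of_mem_closedBall (by simpa [χ] using hu)
    simp [this]
  · intro u hu
    have : χ u = 0 := χ.zero_of_le_dist (by simpa [χ] using hu)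
    simp [this]
  · intro u
    exact (h1 u).trans ((le_max_left _ _).trans (le_max_right _ _))
  · intro u
    exact (h2 u).trans ((le_max_right _ _).trans (le_max_right _ _))

lemma contDiff_sum {ι : Type*} {θ : ℝ → ℝ} {C : ℝ} (hC : 0 < C) (hθ : ContDiff ℝ 1 θ)
    (hb : ∀ u, |θ u| ≤ C) (hb' : ∀ u, |deriv θ u| ≤ C) (ε k w x : ι → ℝ) (hε : Summable ε)
    (hk : ∀ i, |k i| ≤ ε i) (hw : ∀ i, 0 < w i) (hw1 : ∀ i, w i ≤ 2) :
    ContDiff ℝ 1 (fun u => ∑' i, k i * w i * θ ((u - x i) / w i)) ∧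
    ∀ u, Summable (fun i => k i * w i * θ ((u - x i) / w i)) := by
  have hbd : ∀ i u, ‖k i * w i * θ ((u - x i) / w i)‖ ≤ 2 * C * ε i := by
    intro i u
    rw [Real.norm_eq_abs, abs_mul, abs_mul, abs_of_pos (hw i)]
    have := hk i
    have := hb ((u - x i) / w i)
    have := hw1 i
    calc |k i| * w i * |θ ((u - x i) / w i)| ≤ ε i * 2 * C := by
          have := hw i
          have := (abs_nonneg (k i)).trans (hk i)
          gcongr
      _ = _ := by ring
  have hsum : Summable (fun i => 2 * C * ε i) := hε.mul_left _
  refine ⟨?_, fun u => hsum.of_norm_bounded (fun i => hbd i u)⟩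
  refine contDiff_tsum (N := 1) (v := fun _ i => 2 * C * ε i) ?_ (fun _ _ => hsum) ?_
  · intro i
    exact contDiff_const.mul (hθ.comp ((contDiff_id.sub contDiff_const).div_const _))
  · intro n i u hn
    have hn' : n ≤ 1 := by exact_mod_cast hn
    rw [norm_iteratedFDeriv_eq_norm_iteratedDeriv]
    interval_cases n
    · rw [iteratedDeriv_zero]; exact hbd i u
    · rw [iteratedDeriv_one]
      have hd : HasDerivAt (fun u => k i * w i * θ ((u - x i) / w i))
          (k i * w i * (deriv θ ((u - x i) / w i) * (1 / w i))) u := by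
        have h1 : HasDerivAt (fun u => (u - x i) / w i) (1 / w i) u :=
          ((hasDerivAt_id u).sub_const _).div_const _
        have h2 : HasDerivAt θ (deriv θ ((u - x i) / w i)) ((u - x i) / w i) :=
          ((hθ.differentiable one_ne_zero) _).hasDerivAt
        exact (h2.comp u h1).const_mul _
      rw [hd.deriv]
      have hw0 := (hw i).ne'
      have : k i * w i * (deriv θ ((u - x i) / w i) * (1 / w i)) =
        k i * deriv θ ((u - x i) / w i) := by field_simp
      rw [this, Real.norm_eq_abs, abs_mul]
      have h0 := (abs_nonneg (k i)).trans (hk i)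
      calc _ ≤ ε i * C := mul_le_mul (hk i) (hb' _) (abs_nonneg _) h0
        _ ≤ _ := by nlinarith [mul_nonneg h0 hC.le]

/-- The branch through `t` which is eventually `false`. -/
def ext (t : List Bool) : ℕ → Bool := fun n => t.reverse.getD n false

lemma ext_false (t : List Bool) : ext (false :: t) = ext t := by
  funext n
  simp only [ext, List.reverse_cons, List.getD_eq_getElem?_getD, List.getElem?_append]
  split_ifs with h
  · rfl
  · push Not at h
    rw [List.getElem?_eq_none h]
    rcases hn : n - t.reverse.length with _ | m <;> simp

open PiNat in
lemma res_ext (t : List Bool) : res (ext t) t.length = t := by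
  induction t with
  | nil => rfl
  | cons c t ih =>
    rw [List.length_cons, res_succ]
    congr 1
    · simp [ext]
    · conv_rhs => rw [← ih]
      rw [res_eq_res]
      intro m hm
      simp only [ext, List.reverse_cons, List.getD_eq_getElem?_getD]
      rw [List.getElem?_append_left (by simpa using hm)]

open PiNat in
lemma extend (x y : (ℕ → Bool) → ℝ) (r A B ε : List Bool → ℝ)
    (hr0 : ∀ t, 0 < r t) (hr : ∀ t, r t ≤ (1 / 2) ^ t.length)
    (hx : ∀ t z z', res z t.length = t → res z' t.length = t → |x z - x z'| ≤ 2 * r t)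
    (hy : ∀ t z z', res z t.length = t → res z' t.length = t → |y z - y z'| ≤ 2 * r t)
    (hsep : ∀ t z z', res z t.length = t → res z' t.length ≠ t → 4 * r t ≤ |x z - x z'|)
    (hsl : ∀ t z z', res z (t.length + 1) = false :: t → res z' (t.length + 1) = true :: t →
        x z < x z' ∧ A t * (x z' - x z) < y z' - y z ∧ y z' - y z < B t * (x z' - x z))
    (hA : ∀ t c, A t ≤ A (c :: t)) (hB : ∀ t c, B (c :: t) ≤ B t) (hAB : ∀ t, B t - A t ≤ ε t)
    (hε : Summable ε) :
    ∃ F : ℝ → ℝ, ContDiff ℝ 1 F ∧ ∀ z, y z = F (x z) := by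
  obtain ⟨θ, C, hC, hθ, hθ1, hθ0, hb, hb'⟩ := exists_theta
  let xt : List Bool → ℝ := fun t => x (ext t)
  let yt : List Bool → ℝ := fun t => y (ext t)
  let m : List Bool → ℝ := fun t => (yt (true :: t) - yt t) / (xt (true :: t) - xt t)
  have hsl' : ∀ t, xt t < xt (true :: t) ∧ A t < m t ∧ m t < B t := by
    intro t
    have h1 := res_ext (false :: t)
    rw [ext_false] at h1
    obtain ⟨h2, h3, h4⟩ := hsl t _ _ h1 (res_ext (true :: t))
    have : 0 < xt (true :: t) - xt t := sub_pos.2 h2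
    exact ⟨h2, (lt_div_iff₀ this).2 h3, (div_lt_iff₀ this).2 h4⟩
  have hm : ∀ t c, |m (c :: t) - m t| ≤ ε t := by
    intro t c
    have h1 := hsl' t
    have h2 := hsl' (c :: t)
    rw [abs_le]
    constructor <;> linarith [hA t c, hB t c, hAB t]
  -- secant lines
  have hline : ∀ t c, yt (c :: t) = yt t + m t * (xt (c :: t) - xt t) := by
    intro t c
    cases c
    · have h1 : yt (false :: t) = yt t := by simp only [yt, ext_false]
      have h2 : xt (false :: t) = xt t := by simp only [xt, ext_false]
      rw [h1, h2]; ring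
    · have := sub_pos.2 (hsl' t).1
      simp only [m]
      field_simp
      ring
  let φ : Bool → List Bool → ℝ → ℝ := fun c t u =>
    (m (c :: t) - m t) * (2 * r (c :: t)) * θ ((u - xt (c :: t)) / (2 * r (c :: t)))
  have hφ : ∀ c, ContDiff ℝ 1 (fun u => ∑' t, φ c t u) ∧ ∀ u, Summable (fun t => φ c t u) := by
    intro c
    refine contDiff_sum hC hθ hb hb' ε (fun t => m (c :: t) - m t) (fun t => 2 * r (c :: t))
      (fun t => xt (c :: t)) hε (fun t => hm t c) (fun t => by have := hr0 (c :: t); positivity) ?_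
    intro t
    have := hr (c :: t)
    have h2 : ((1 : ℝ) / 2) ^ (c :: t).length ≤ 1 := pow_le_one₀ (by norm_num) (by norm_num)
    linarith
  have hval1 : ∀ c t z, res z (t.length + 1) = c :: t →
      φ c t (x z) = (m (c :: t) - m t) * (x z - xt (c :: t)) := by
    intro c t z h
    have h1 := hx (c :: t) z (ext (c :: t)) h (res_ext _)
    have h2 := hr0 (c :: t)
    simp only [φ]
    rw [hθ1]
    · field_simp
    · rw [abs_div, abs_of_pos (by positivity : 0 < 2 * r (c :: t)), div_le_one (by positivity)]
      exact h1
  have hval0 : ∀ c t z, res z (t.length + 1) ≠ c :: t → φ c t (x z) = 0 := by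
    intro c t z h
    have h1 := hsep (c :: t) (ext (c :: t)) z (res_ext _) h
    have h2 := hr0 (c :: t)
    simp only [φ]
    rw [hθ0, mul_zero]
    rw [abs_div, abs_of_pos (by positivity : 0 < 2 * r (c :: t)), le_div_iff₀ (by positivity),
      abs_sub_comm]
    calc _ = 4 * r (c :: t) := by ring
      _ ≤ _ := h1
  refine ⟨fun u => (yt [] + m [] * (u - xt [])) + ((∑' t, φ false t u) + ∑' t, φ true t u),
    ContDiff.add (by fun_prop) ((hφ false).1.add (hφ true).1), ?_⟩
  intro z
  have hS := ((hφ false).2 (x z)).hasSum.add ((hφ true).2 (x z)).hasSum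
  have hinj : Function.Injective (fun n => res z n) := by
    intro i j h
    have := congrArg List.length h
    simpa using this
  rw [← hinj.hasSum_iff] at hS
  swap
  · intro t ht
    have hne : ∀ c, res z (t.length + 1) ≠ c :: t := by
      intro c hc
      rw [res_succ, List.cons.injEq] at hc
      exact ht ⟨t.length, hc.2⟩
    rw [hval0 _ _ _ (hne _), hval0 _ _ _ (hne _), add_zero]
  have hlim := hS.tendsto_sum_nat
  let Lz : ℕ → ℝ := fun n => yt (res z n) + m (res z n) * (x z - xt (res z n))
  have hterm : ∀ n, φ false (res z n) (x z) + φ true (res z n) (x z) = Lz (n + 1) - Lz n := by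
    intro n
    have hres : res z ((res z n).length + 1) = z n :: res z n := by rw [res_length, res_succ]
    have hL : Lz (n + 1) - Lz n = (m (z n :: res z n) - m (res z n)) *
        (x z - xt (z n :: res z n)) := by
      simp only [Lz, res_succ]
      rw [hline (res z n) (z n)]
      ring
    rw [hL]
    cases hzn : z n
    · rw [hzn] at hres
      rw [hval1 _ _ _ hres, hval0 true _ _ (by rw [hres]; simp), add_zero]
    · rw [hzn] at hres
      rw [hval1 _ _ _ hres, hval0 false _ _ (by rw [hres]; simp), zero_add]
  have hpart : ∀ n, ∑ i ∈ Finset.range n, ((fun b => φ false b (x z) + φ true b (x z)) ∘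
      fun n => res z n) i = Lz n - Lz 0 := by
    intro n
    rw [← Finset.sum_range_sub]
    exact Finset.sum_congr rfl fun i _ => hterm i
  simp only [hpart] at hlim
  have hmb : ∀ t, A [] ≤ A t ∧ B t ≤ B [] := by
    intro t
    induction t with
    | nil => exact ⟨le_rfl, le_rfl⟩
    | cons c t ih => exact ⟨ih.1.trans (hA t c), (hB t c).trans ih.2⟩
  have hLlim : Tendsto Lz atTop (𝓝 (y z)) := by
    let K := max |A []| |B []|
    have hK : ∀ t, |m t| ≤ K := by
      intro t
      have h1 := hsl' t
      have h2 := hmb t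
      exact abs_le_max_abs_abs (by linarith) (by linarith)
    have hz : Tendsto (fun n : ℕ => (2 * (1 + K)) * ((1 : ℝ) / 2) ^ n) atTop
        (𝓝 ((2 * (1 + K)) * 0)) :=
      (tendsto_pow_atTop_nhds_zero_of_lt_one (by norm_num) (by norm_num)).const_mul _
    rw [mul_zero] at hz
    rw [tendsto_iff_dist_tendsto_zero]
    refine squeeze_zero (fun _ => dist_nonneg) (fun n => ?_) hz
    have e0 : res z (res z n).length = res z n := by rw [res_length]
    have e1 := hx (res z n) z (ext (res z n)) e0 (res_ext _)
    have e2 := hy (res z n) (ext (res z n)) z (res_ext _) e0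
    have e3 := hr (res z n)
    have e4 := hK (res z n)
    rw [res_length] at e3
    have e5 := hr0 (res z n)
    have hK0 : 0 ≤ K := (abs_nonneg _).trans e4
    rw [Real.dist_eq]
    have : Lz n - y z = (yt (res z n) - y z) + m (res z n) * (x z - xt (res z n)) := by
      simp only [Lz]; ring
    rw [this]
    calc _ ≤ |yt (res z n) - y z| + |m (res z n) * (x z - xt (res z n))| := abs_add_le _ _
      _ ≤ 2 * r (res z n) + K * (2 * r (res z n)) := by
        rw [abs_mul]
        gcongr
      _ = 2 * (1 + K) * r (res z n) := by ring
      _ ≤ _ := by gcongr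
  have hfin := tendsto_nhds_unique (hLlim.sub_const (Lz 0)) hlim
  have hL0 : Lz 0 = yt [] + m [] * (x z - xt []) := rfl
  beta_reduce
  rw [← hfin, hL0]
  ring


open PiNat in
lemma cantor {E : Type*} [MetricSpace E] [CompleteSpace E] {X Y : E → ℝ}
    (hX : LipschitzWith 1 X) (hY : LipschitzWith 1 Y) {P : Set E}
    (hP : IsClosed P) {U : Set E} (hU : IsOpen U) (hUP : (U ∩ P).Nonempty) {a b : ℝ}
    (hG : Good X Y P U a b) :
    ∃ F : ℝ → ℝ, ContDiff ℝ 1 F ∧ ∃ Q ⊆ P, Q.Nonempty ∧ IsCompact Q ∧ Perfect Q ∧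
      Nonempty (Q ≃ₜ (ℕ → Bool)) ∧ ∀ p ∈ Q, Y p = F (X p) := by
  obtain ⟨ε, hε0, c, hεs, -⟩ := posSumOfEncodable one_pos (List Bool)
  obtain ⟨f, r, A, B, hfP, hr0, hr, hd, hsep, hsl, hA, hB, hAB⟩ :=
    fusion hX hY hP hU hUP hG ε hε0
  have hXd : ∀ p q, |X p - X q| ≤ dist p q := fun p q => by
    simpa [Real.dist_eq] using hX.dist_le_mul p q
  have hYd : ∀ p q, |Y p - Y q| ≤ dist p q := fun p q => by
    simpa [Real.dist_eq] using hY.dist_le_mul p q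
  obtain ⟨F, hF, hFv⟩ := extend (fun z => X (f z)) (fun z => Y (f z)) r A B ε hr0 hr
    (fun t z z' h h' => (hXd _ _).trans (hd t z z' h h'))
    (fun t z z' h h' => (hYd _ _).trans (hd t z z' h h')) hsep hsl hA hB hAB hεs.summable
  have hinj : Function.Injective f := by
    intro z z' h
    by_contra hne
    obtain ⟨n, hn⟩ := Function.ne_iff.1 hne
    have h1 := hsep (res z (n + 1)) z z' (by rw [res_length]) (by
      rw [res_length, Ne, res_eq_res]
      intro hh
      exact hn (hh (Nat.lt_succ_self n)).symm)
    have h2 := hr0 (res z (n + 1))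
    rw [h, sub_self, abs_zero] at h1
    linarith
  have hcont : Continuous f := by
    rw [continuous_iff_continuousAt]
    intro z
    rw [ContinuousAt, Metric.tendsto_nhds]
    intro δ hδ
    obtain ⟨n, hn⟩ := exists_pow_lt_of_lt_one (half_pos hδ) (by norm_num : (1 : ℝ) / 2 < 1)
    have : cylinder z n ∈ 𝓝 z := (isOpen_cylinder _ z n).mem_nhds (self_mem_cylinder z n)
    filter_upwards [this] with z' hz'
    rw [cylinder_eq_res] at hz'
    have h1 := hd (res z n) z' z (by rw [res_length]; exact hz') (by rw [res_length])
    have h2 := hr (res z n)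
    rw [res_length] at h2
    linarith
  have hemb := hcont.isClosedEmbedding hinj
  refine ⟨F, hF, range f, range_subset_iff.2 hfP, range_nonempty f, isCompact_range hcont,
    ⟨hemb.isClosed_range, ?_⟩, ⟨hemb.isEmbedding.toHomeomorph.symm⟩, ?_⟩
  · rw [preperfect_iff_nhds]
    rintro _ ⟨z, rfl⟩ V hV
    have hlim : Tendsto (fun n => Function.update z n (!(z n))) atTop (𝓝 z) := by
      rw [tendsto_pi_nhds]
      intro k
      refine tendsto_const_nhds.congr' ?_
      filter_upwards [eventually_gt_atTop k] with n hn
      rw [Function.update_of_ne hn.ne]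
    obtain ⟨n, hn⟩ := (((hcont.tendsto z).comp hlim).eventually hV).exists
    refine ⟨_, ⟨hn, mem_range_self _⟩, ?_⟩
    intro h
    have := congrFun (hinj h) n
    simp at this
  · rintro _ ⟨z, rfl⟩
    exact hFv z

lemma lip_coord (i : Fin 2) : LipschitzWith 1 (fun p : EuclideanSpace ℝ (Fin 2) => p i) := by
  refine LipschitzWith.of_dist_le_mul fun p q => ?_
  rw [NNReal.coe_one, one_mul, dist_eq_norm, dist_eq_norm]
  exact PiLp.norm_apply_le (p - q) i

end CArc

open CArc in

theorem stmt_10 (P : Set (EuclideanSpace ℝ (Fin 2))) (hPclosed : IsClosed P)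
    (hPunc : ¬ P.Countable) :
    ∃ R : EuclideanSpace ℝ (Fin 2) ≃ₗᵢ[ℝ] EuclideanSpace ℝ (Fin 2),
      ∃ F : ℝ → ℝ, ContDiff ℝ 1 F ∧
        ∃ Q ⊆ P, Q.Nonempty ∧ IsCompact Q ∧ Perfect Q ∧
          Nonempty (Q ≃ₜ (ℕ → Bool)) ∧
          ∀ p ∈ Q, (R p) 1 = F ((R p) 0) := by
  obtain ⟨D, hD, hDne, hDP⟩ :=
    exists_perfect_nonempty_of_isClosed_of_not_countable hPclosed hPunc
  by_cases hG : Good (fun p : EuclideanSpace ℝ (Fin 2) => p 0) (fun p => p 1) D Set.univ (-2) 2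
  · obtain ⟨F, hF, Q, hQ, h1, h2, h3, h4, h5⟩ := cantor (lip_coord 0) (lip_coord 1) hD.closed
      isOpen_univ (by simpa using hDne) hG
    exact ⟨LinearIsometryEquiv.refl ℝ _, F, hF, Q, hQ.trans hDP, h1, h2, h3, h4, h5⟩
  · unfold Good at hG
    push Not at hG
    obtain ⟨V, -, hV, hVne, hno⟩ := hG
    have hG' : Good (fun p : EuclideanSpace ℝ (Fin 2) => p 1) (fun p => p 0) D V (-2) 2 := by
      intro W hWV hW hWne
      obtain ⟨p, hpW, hpD⟩ := hWne
      obtain ⟨q, ⟨hqW, hqD⟩, hqp⟩ := preperfect_iff_nhds.1 hD.acc p hpD W (hW.mem_nhds hpW)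
      have n1 := hno p ⟨hWV hpW, hpD⟩ q ⟨hWV hqW, hqD⟩
      have n2 := hno q ⟨hWV hqW, hqD⟩ p ⟨hWV hpW, hpD⟩
      simp only [Pr, not_and, not_lt] at n1 n2
      have key : ∀ u v : EuclideanSpace ℝ (Fin 2), u 1 < v 1 →
          (u 0 < v 0 → -2 * (v 0 - u 0) < v 1 - u 1 → 2 * (v 0 - u 0) ≤ v 1 - u 1) →
          (v 0 < u 0 → -2 * (u 0 - v 0) < u 1 - v 1 → 2 * (u 0 - v 0) ≤ u 1 - v 1) →
          Pr (fun p : EuclideanSpace ℝ (Fin 2) => p 1) (fun p => p 0) (-2) 2 u v := by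
        intro u v h m1 m2
        refine ⟨h, ?_, ?_⟩
        · by_contra hc
          push Not at hc
          have := m2 (by linarith) (by linarith)
          linarith
        · by_contra hc
          push Not at hc
          have := m1 (by linarith) (by linarith)
          linarith
      rcases lt_trichotomy (p 1) (q 1) with h | h | h
      · exact ⟨p, ⟨hpW, hpD⟩, q, ⟨hqW, hqD⟩, key p q h n1 n2⟩
      · exfalso
        rcases lt_trichotomy (p 0) (q 0) with h' | h' | h'
        · have := n1 h' (by linarith)
          linarith
        · apply hqp
          ext i
          fin_cases i
          · exact h'.symm
          · exact h.symm
        · have := n2 h' (by linarith)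
          linarith
      · exact ⟨q, ⟨hqW, hqD⟩, p, ⟨hpW, hpD⟩, key q p h n2 n1⟩
    obtain ⟨F, hF, Q, hQ, h1, h2, h3, h4, h5⟩ := cantor (lip_coord 1) (lip_coord 0) hD.closed
      hV hVne hG'
    refine ⟨LinearIsometryEquiv.piLpCongrLeft 2 ℝ ℝ (Equiv.swap 0 1), F, hF, Q, hQ.trans hDP,
      h1, h2, h3, h4, ?_⟩
    intro p hp
    have := h5 p hp
    simpa [LinearIsometryEquiv.piLpCongrLeft_apply, Equiv.piCongrLeft'_apply] using this
end

section
/- Let D ⊆ ℝ be a Cantor set (nonempty compact perfect nowhere dense). Then there exists a strictly increasing f ∈ C^∞(ℝ) with f'(x) ≥ 0 for all x and D = {x : f'(x) = 0}. -/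
theorem stmt_12 (D : Set ℝ) (hDne : D.Nonempty) (hDcomp : IsCompact D)
    (hDperf : Perfect D) (hDnd : interior D = ∅) :
    ∃ f : ℝ → ℝ, ContDiff ℝ (⊤ : ℕ∞) f ∧ StrictMono f ∧
      (∀ x, 0 ≤ deriv f x) ∧ {x : ℝ | deriv f x = 0} = D := by
  obtain ⟨g, gs, gd, gr⟩ :=
    (hDcomp.isClosed.isOpen_compl).exists_contDiff_support_eq (n := (⊤ : ℕ∞))
  have gc : Continuous g := gd.continuous
  have g0 : ∀ x, 0 ≤ g x := fun x => (gr ⟨x, rfl⟩).1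
  have hgD : ∀ x, g x = 0 ↔ x ∈ D := by
    intro x
    have h : x ∈ Function.support g ↔ x ∈ Dᶜ := by rw [gs]
    rw [Function.mem_support, Set.mem_compl_iff] at h
    exact not_iff_not.mp h
  have hd : ∀ x, HasDerivAt (fun y => ∫ t in (0 : ℝ)..y, g t) (g x) x := fun x =>
    intervalIntegral.integral_hasDerivAt_right (gc.intervalIntegrable _ _)
      gc.stronglyMeasurable.stronglyMeasurableAtFilter gc.continuousAt
  generalize (fun y => ∫ t in (0 : ℝ)..y, g t) = f at hd
  have hfd : Differentiable ℝ f := fun x => (hd x).differentiableAt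
  have hderiv : deriv f = g := funext fun x => (hd x).deriv
  have hmono : Monotone f := monotone_of_deriv_nonneg hfd (by rw [hderiv]; exact g0)
  refine ⟨f, ?_, ?_, ?_, ?_⟩
  · exact contDiff_infty_iff_deriv.2 ⟨hfd, by rw [hderiv]; exact gd⟩
  · intro a b hab
    refine lt_of_le_of_ne (hmono hab.le) fun hEq => ?_
    have hsub : Set.Ioo a b ⊆ D := by
      intro x hx
      rw [← hgD, ← hderiv]
      have : f =ᶠ[nhds x] fun _ => f a := by
        filter_upwards [isOpen_Ioo.mem_nhds hx] with y hy
        exact le_antisymm (hEq ▸ hmono hy.2.le) (hmono hy.1.le)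
      rw [this.deriv_eq]
      simp
    have h2 : Set.Ioo a b ⊆ interior D := interior_maximal hsub isOpen_Ioo
    rw [hDnd] at h2
    exact h2 (Set.nonempty_Ioo.2 hab).some_mem
  · rw [hderiv]; exact g0
  · ext x
    rw [Set.mem_setOf_eq, hderiv, hgD]
end

section
/- There is a perfect set P ⊆ ℝ² which lies in the graph of a C^∞ function ℝ → ℝ and which meets every non-squiggly subset of ℝ² in a countable set. -/
/-- `A ⊆ ℝ²` is non-squiggly: for some `δ ∈ (0,∞]`, whenever four distinct points
of `A` have diameter at most `δ`, none of them is interior to the triangle spanned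
by the other three. -/
def NonSquiggly (A : Set (ℝ × ℝ)) : Prop :=
  ∃ δ : ENNReal, 0 < δ ∧ ∀ x ∈ A, ∀ y ∈ A, ∀ z ∈ A, ∀ t ∈ A,
    ({x, y, z, t} : Set (ℝ × ℝ)).ncard = 4 →
    EMetric.diam ({x, y, z, t} : Set (ℝ × ℝ)) ≤ δ →
    t ∉ interior (convexHull ℝ ({x, y, z} : Set (ℝ × ℝ)))

open Set Filter Topology

/-- Oriented area of a triangle (doubled). -/
def crossD (u v w : ℝ × ℝ) : ℝ :=
  (v.1 - u.1) * (w.2 - u.2) - (v.2 - u.2) * (w.1 - u.1)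

lemma mem_hull_of_cross (p r y t : ℝ × ℝ) (h1 : 0 < crossD p y t) (h2 : 0 < crossD y r t)
    (h3 : 0 < crossD r p t) : t ∈ convexHull ℝ ({p, r, y} : Set (ℝ × ℝ)) := by
  set S := crossD p y t + crossD y r t + crossD r p t with hS
  have hS0 : 0 < S := by positivity
  have hp : p ∈ convexHull ℝ ({p, r, y} : Set (ℝ × ℝ)) := subset_convexHull _ _ (by simp)
  have hr : r ∈ convexHull ℝ ({p, r, y} : Set (ℝ × ℝ)) := subset_convexHull _ _ (by simp)
  have hy : y ∈ convexHull ℝ ({p, r, y} : Set (ℝ × ℝ)) := subset_convexHull _ _ (by simp)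
  have hc := (convex_convexHull ℝ ({p, r, y} : Set (ℝ × ℝ))).sum_mem
    (t := Finset.univ) (w := ![crossD y r t / S, crossD p y t / S, crossD r p t / S])
    (z := ![p, r, y])
    (by intro i _; fin_cases i <;> simp <;> positivity)
    (by simp [Fin.sum_univ_three]; field_simp; rw [hS]; ring)
    (by intro i _; fin_cases i <;> simp [hp, hr, hy])
  convert hc using 1
  simp only [Fin.sum_univ_three]
  ext
  · simp
    field_simp
    rw [hS]; simp only [crossD]; ring
  · simp
    field_simp
    rw [hS]; simp only [crossD]; ring

lemma mem_interior_of_cross (p r y t : ℝ × ℝ) (h1 : 0 < crossD p y t) (h2 : 0 < crossD y r t)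
    (h3 : 0 < crossD r p t) : t ∈ interior (convexHull ℝ ({p, r, y} : Set (ℝ × ℝ))) := by
  refine mem_interior.2 ⟨{t | 0 < crossD p y t} ∩ {t | 0 < crossD y r t} ∩ {t | 0 < crossD r p t},
    ?_, ?_, ⟨⟨h1, h2⟩, h3⟩⟩
  · rintro s ⟨⟨a, b⟩, c⟩
    exact mem_hull_of_cross p r y s a b c
  · have : ∀ u v : ℝ × ℝ, IsOpen {t | 0 < crossD u v t} := by
      intro u v
      apply isOpen_lt continuous_const
      unfold crossD
      fun_prop
    exact ((this _ _).inter (this _ _)).inter (this _ _)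

/-! ### Uncountable subsets of the Cantor space -/

lemma exists_condensation {X : Type*} [TopologicalSpace X] [SecondCountableTopology X]
    (B : Set X) (hB : ¬ B.Countable) :
    ¬ {x ∈ B | ∀ U ∈ 𝓝 x, ¬ (B ∩ U).Countable}.Countable := by
  intro h
  apply hB
  set C := {x ∈ B | ∀ U ∈ 𝓝 x, ¬ (B ∩ U).Countable} with hC
  have key : ∀ x ∈ B \ C, ∃ U ∈ 𝓝 x, (B ∩ U).Countable := by
    rintro x ⟨hx, hxC⟩
    by_contra hcon
    push Not at hcon
    exact hxC ⟨hx, hcon⟩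
  choose! U hU hUc using key
  obtain ⟨t, hts, htc, hcov⟩ := TopologicalSpace.countable_cover_nhdsWithin
    (f := U) (s := B \ C) (fun x hx => mem_nhdsWithin_of_mem_nhds (hU x hx))
  have h2 : (⋃ x ∈ t, B ∩ U x).Countable := htc.biUnion fun x hx => hUc x (hts hx)
  refine (h.union h2).mono ?_
  intro x hx
  by_cases hxC : x ∈ C
  · exact Or.inl hxC
  · right
    have := hcov ⟨hx, hxC⟩
    simp only [mem_iUnion] at this ⊢
    obtain ⟨i, hi, hxi⟩ := this
    exact ⟨i, hi, hx, hxi⟩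

lemma cyl_mem_nhds (x : ℕ → Bool) (n : ℕ) : {y : ℕ → Bool | ∀ i ≤ n, y i = x i} ∈ 𝓝 x := by
  have : {y : ℕ → Bool | ∀ i ≤ n, y i = x i} = ⋂ i ∈ Set.Iic n, {y | y i = x i} := by
    ext; simp
  rw [this, biInter_mem (Set.finite_Iic n)]
  intro i _
  have : IsOpen {y : ℕ → Bool | y i = x i} :=
    (isOpen_discrete ({x i} : Set Bool)).preimage (continuous_apply i : Continuous fun y : ℕ → Bool => y i)
  exact this.mem_nhds rfl

/-- `x` and `y` first differ at `n`, where `x` goes left and `y` goes right. -/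
def SplitAt (n : ℕ) (x y : ℕ → Bool) : Prop :=
  (∀ i < n, x i = y i) ∧ x n = false ∧ y n = true

lemma exists_splitAt (x y : ℕ → Bool) (h : x ≠ y) : ∃ n, SplitAt n x y ∨ SplitAt n y x := by
  have h' : ∃ n, x n ≠ y n := Function.ne_iff.1 h
  classical
  refine ⟨Nat.find h', ?_⟩
  have h1 := Nat.find_spec h'
  have h2 : ∀ i < Nat.find h', x i = y i := fun i hi => by
    have := Nat.find_min h' hi
    push Not at this; exact this
  generalize Nat.find h' = n at *
  cases hx : x n <;> cases hy : y n <;> simp_all [SplitAt]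

lemma exists_split (B : Set (ℕ → Bool)) (hB : ¬ B.Countable) :
    ∃ (n : ℕ) (L R : Set (ℕ → Bool)), L ⊆ B ∧ R ⊆ B ∧ ¬ L.Countable ∧ ¬ R.Countable ∧
      (∀ x ∈ L, ∀ y ∈ R, SplitAt n x y) ∧
      (∀ x ∈ L, ∀ y ∈ L, ∀ i ≤ n, x i = y i) ∧ (∀ x ∈ R, ∀ y ∈ R, ∀ i ≤ n, x i = y i) := by
  have hC := exists_condensation B hB
  have hnt : {x ∈ B | ∀ U ∈ 𝓝 x, ¬ (B ∩ U).Countable}.Nontrivial := by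
    by_contra h
    rw [Set.not_nontrivial_iff] at h
    exact hC h.countable
  obtain ⟨x, ⟨hxB, hx⟩, y, ⟨hyB, hy⟩, hxy⟩ := hnt
  have main : ∀ x y : ℕ → Bool, (∀ U ∈ 𝓝 x, ¬ (B ∩ U).Countable) →
      (∀ U ∈ 𝓝 y, ¬ (B ∩ U).Countable) → ∀ n, SplitAt n x y →
      ∃ (n : ℕ) (L R : Set (ℕ → Bool)), L ⊆ B ∧ R ⊆ B ∧ ¬ L.Countable ∧ ¬ R.Countable ∧
      (∀ x ∈ L, ∀ y ∈ R, SplitAt n x y) ∧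
      (∀ x ∈ L, ∀ y ∈ L, ∀ i ≤ n, x i = y i) ∧ (∀ x ∈ R, ∀ y ∈ R, ∀ i ≤ n, x i = y i) := by
    intro x y hx hy n hn
    refine ⟨n, B ∩ {z | ∀ i ≤ n, z i = x i}, B ∩ {z | ∀ i ≤ n, z i = y i}, inter_subset_left,
      inter_subset_left, hx _ (cyl_mem_nhds x n), hy _ (cyl_mem_nhds y n), ?_, ?_, ?_⟩
    · rintro u ⟨_, hu⟩ v ⟨_, hv⟩
      refine ⟨fun i hi => ?_, ?_, ?_⟩
      · rw [hu i hi.le, hv i hi.le, hn.1 i hi]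
      · rw [hu n le_rfl, hn.2.1]
      · rw [hv n le_rfl, hn.2.2]
    · rintro u ⟨_, hu⟩ v ⟨_, hv⟩ i hi
      rw [hu i hi, hv i hi]
    · rintro u ⟨_, hu⟩ v ⟨_, hv⟩ i hi
      rw [hu i hi, hv i hi]
  obtain ⟨n, hn | hn⟩ := exists_splitAt x y hxy
  · exact main x y hx hy n hn
  · exact main y x hy hx n hn

lemma exists_zigzag (B : Set (ℕ → Bool)) (hB : ¬ B.Countable) :
    ∃ y ∈ B, ∃ p ∈ B, ∃ q ∈ B, ∃ r ∈ B, ∃ n₁ n₂ n₃ : ℕ, n₁ < n₂ ∧ n₂ < n₃ ∧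
      SplitAt n₁ y p ∧ SplitAt n₁ y q ∧ SplitAt n₂ q r ∧ SplitAt n₃ p q := by
  obtain ⟨n₁, L₁, R₁, hL₁, hR₁, cL₁, cR₁, s₁, -, a₁⟩ := exists_split B hB
  obtain ⟨n₂, L₂, R₂, hL₂, hR₂, cL₂, cR₂, s₂, a₂, -⟩ := exists_split R₁ cR₁
  obtain ⟨n₃, L₃, R₃, hL₃, hR₃, cL₃, cR₃, s₃, -, -⟩ := exists_split L₂ cL₂
  have ne : ∀ S : Set (ℕ → Bool), ¬ S.Countable → S.Nonempty := by
    intro S hS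
    rw [Set.nonempty_iff_ne_empty]
    rintro rfl
    exact hS countable_empty
  obtain ⟨y, hy⟩ := ne _ cL₁
  obtain ⟨r, hr⟩ := ne _ cR₂
  obtain ⟨p, hp⟩ := ne _ cL₃
  obtain ⟨q, hq⟩ := ne _ cR₃
  have hp2 := hL₃ hp
  have hq2 := hR₃ hq
  have hpq := s₃ p hp q hq
  have hqr := s₂ q hq2 r hr
  refine ⟨y, hL₁ hy, p, hR₁ (hL₂ hp2), q, hR₁ (hL₂ hq2), r, hR₁ (hR₂ hr), n₁, n₂, n₃, ?_, ?_,
    s₁ y hy p (hL₂ hp2), s₁ y hy q (hL₂ hq2), hqr, hpq⟩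
  · by_contra hcon
    have := a₁ q (hL₂ hq2) r (hR₂ hr) n₂ (not_lt.1 hcon)
    rw [hqr.2.1, hqr.2.2] at this
    cases this
  · by_contra hcon
    have := a₂ p hp2 q hq2 n₃ (not_lt.1 hcon)
    rw [hpq.2.1, hpq.2.2] at this
    cases this

/-! ### Weighted digit sums -/

/-- A binary digit as a real number. -/
def dig (b : Bool) : ℝ := if b then 1 else 0

/-- The digit sum with weights `w`. -/
noncomputable def dsum (w : ℕ → ℝ) (x : ℕ → Bool) : ℝ := ∑' n, w n * dig (x n)

lemma dig_nonneg (b : Bool) : 0 ≤ dig b := by cases b <;> simp [dig]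
lemma dig_le_one (b : Bool) : dig b ≤ 1 := by cases b <;> simp [dig]

/-- Rapidly decreasing positive weights. -/
def Rapid (w : ℕ → ℝ) : Prop := (∀ n, 0 < w n) ∧ ∀ n, w (n + 1) ≤ w n / 3

lemma Rapid.le {w : ℕ → ℝ} (h : Rapid w) (n k : ℕ) : w (n + k) ≤ w n * (1 / 3) ^ k := by
  induction k with
  | zero => simp
  | succ k ih =>
    have := h.2 (n + k)
    rw [← add_assoc, pow_succ]
    linarith

lemma term_bound {w : ℕ → ℝ} (h : Rapid w) (n : ℕ) (x : ℕ → Bool) :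
    ‖w n * dig (x n)‖ ≤ w 0 * (1 / 3) ^ n := by
  have h1 := h.le 0 n
  rw [zero_add] at h1
  rw [Real.norm_eq_abs, abs_of_nonneg (mul_nonneg (h.1 n).le (dig_nonneg _))]
  nlinarith [h.1 n, dig_le_one (x n)]

lemma summable_geo (c : ℝ) : Summable fun n : ℕ => c * (1 / 3 : ℝ) ^ n :=
  (summable_geometric_of_lt_one (by norm_num) (by norm_num)).mul_left c

lemma dsum_summable {w : ℕ → ℝ} (h : Rapid w) (x : ℕ → Bool) :
    Summable fun n => w n * dig (x n) :=
  Summable.of_norm_bounded (summable_geo (w 0)) fun n => term_bound h n x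

lemma dsum_continuous {w : ℕ → ℝ} (h : Rapid w) : Continuous (dsum w) := by
  unfold dsum
  refine continuous_tsum (fun n => ?_) (summable_geo (w 0)) fun n x => term_bound h n x
  exact continuous_const.mul ((continuous_of_discreteTopology (f := dig)).comp (continuous_apply n))

lemma dsum_diff {w : ℕ → ℝ} (h : Rapid w) (n : ℕ) (x y : ℕ → Bool) (hs : SplitAt n x y) :
    w n / 2 ≤ dsum w y - dsum w x ∧ dsum w y - dsum w x ≤ 3 / 2 * w n := by
  have e : dsum w y - dsum w x = ∑' i, (w i * dig (y i) - w i * dig (x i)) :=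
    ((dsum_summable h y).tsum_sub (dsum_summable h x)).symm
  have hsum := (dsum_summable h y).sub (dsum_summable h x)
  rw [← hsum.sum_add_tsum_nat_add (n + 1)] at e
  have e0 : ∑ i ∈ Finset.range (n + 1), (w i * dig (y i) - w i * dig (x i)) = w n := by
    rw [Finset.sum_range_succ, Finset.sum_eq_zero]
    · simp [hs.2.1, hs.2.2, dig]
    · intro i hi
      rw [hs.1 i (Finset.mem_range.1 hi)]; simp
  rw [e0] at e
  have hb : ‖∑' i, (w (i + (n + 1)) * dig (y (i + (n + 1)))
      - w (i + (n + 1)) * dig (x (i + (n + 1))))‖ ≤ w n / 2 := by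
    have hg : HasSum (fun i : ℕ => (w n / 3) * (1 / 3 : ℝ) ^ i) ((w n / 3) * (1 - 1 / 3)⁻¹) :=
      (hasSum_geometric_of_lt_one (by norm_num) (by norm_num)).mul_left _
    have hg' : (w n / 3) * (1 - 1 / 3)⁻¹ = w n / 2 := by norm_num; ring
    rw [hg'] at hg
    refine tsum_of_norm_bounded hg fun i => ?_
    have h1 := h.le n (i + 1)
    have h2 : n + (i + 1) = i + (n + 1) := by ring
    rw [h2, pow_succ] at h1
    have h3 := h.1 (i + (n + 1))
    have h4 : ‖w (i + (n + 1)) * dig (y (i + (n + 1)))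
      - w (i + (n + 1)) * dig (x (i + (n + 1)))‖ ≤ w (i + (n + 1)) := by
      rw [Real.norm_eq_abs, abs_le]
      constructor <;> nlinarith [dig_le_one (x (i + (n + 1))), dig_le_one (y (i + (n + 1))),
        dig_nonneg (x (i + (n + 1))), dig_nonneg (y (i + (n + 1)))]
    linarith
  rw [Real.norm_eq_abs, abs_le] at hb
  constructor <;> linarith [hb.1, hb.2]

lemma dsum_injective {w : ℕ → ℝ} (h : Rapid w) : Function.Injective (dsum w) := by
  intro x y hxy
  by_contra hne
  obtain ⟨n, hn | hn⟩ := exists_splitAt x y hne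
  · have := (dsum_diff h n x y hn).1
    have := h.1 n
    linarith
  · have := (dsum_diff h n y x hn).1
    have := h.1 n
    linarith

/-! ### The smooth function -/

lemma exists_digit_fun {a : ℕ → ℝ} (ha : Rapid a) (n : ℕ) :
    ∃ φ : ℝ → ℝ, ContDiff ℝ (⊤ : ℕ∞) φ ∧ HasCompactSupport φ ∧
      ∀ x, φ (dsum a x) = dig (x n) := by
  have hcl : ∀ b : Bool, IsCompact (dsum a '' {x | x n = b}) := by
    intro b
    have : IsClosed {x : ℕ → Bool | x n = b} :=
      (isClosed_discrete ({b} : Set Bool)).preimage (continuous_apply n : Continuous fun y : ℕ → Bool => y n)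
    exact this.isCompact.image (dsum_continuous ha)
  have hd : Disjoint (dsum a '' {x | x n = false}) (dsum a '' {x | x n = true}) := by
    rw [Set.disjoint_left]
    rintro _ ⟨x, hx, rfl⟩ ⟨y, hy, hxy⟩
    have := dsum_injective ha hxy
    subst this
    simp only [mem_ofPred_eq] at hx hy
    rw [hx] at hy
    cases hy
  obtain ⟨R, hR⟩ := (hcl true).isBounded.subset_ball (0 : ℝ)
  have hd2 : Disjoint ((dsum a '' {x | x n = false}) ∪ (Metric.ball (0 : ℝ) R)ᶜ)
      (dsum a '' {x | x n = true}) := by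
    rw [Set.disjoint_union_left]
    exact ⟨hd, Set.disjoint_left.2 fun z hz hz' => hz (hR hz')⟩
  obtain ⟨f, hf0, hf1, -⟩ := exists_contMDiffMap_zero_one_of_isClosed
    (n := (⊤ : ℕ∞)) (modelWithCornersSelf ℝ ℝ)
    ((hcl false).isClosed.union Metric.isOpen_ball.isClosed_compl) (hcl true).isClosed hd2
  refine ⟨f, f.contMDiff.contDiff, ?_, ?_⟩
  · refine HasCompactSupport.intro (isCompact_closedBall (0 : ℝ) R) fun z hz => ?_
    exact hf0 (Or.inr fun h => hz (Metric.ball_subset_closedBall h))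
  · intro x
    cases hx : x n
    · exact (hf0 (Or.inl ⟨x, hx, rfl⟩)).trans (by simp [dig])
    · exact (hf1 ⟨x, hx, rfl⟩).trans (by simp [dig])

lemma exists_deriv_bound (φ : ℝ → ℝ) (h : ContDiff ℝ (⊤ : ℕ∞) φ) (hc : HasCompactSupport φ)
    (n : ℕ) : ∃ C : ℝ, 0 < C ∧ ∀ k ≤ n, ∀ x, ‖iteratedFDeriv ℝ k φ x‖ ≤ C := by
  have : ∀ k : ℕ, ∃ C : ℝ, ∀ x, ‖iteratedFDeriv ℝ k φ x‖ ≤ C := fun k =>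
    (hc.iteratedFDeriv k).exists_bound_of_continuous
      (h.continuous_iteratedFDeriv (by exact_mod_cast le_top))
  choose C hC using this
  refine ⟨1 + ∑ k ∈ Finset.range (n + 1), |C k|, by positivity, fun k hk x => ?_⟩
  have h1 := Finset.single_le_sum (f := fun k => |C k|) (s := Finset.range (n + 1))
    (fun i _ => abs_nonneg _) (Finset.mem_range.2 (Nat.lt_succ_of_le hk))
  have h2 := hC k x
  have h3 := le_abs_self (C k)
  linarith

lemma exists_smooth {a : ℕ → ℝ} (ha : Rapid a) :
    ∃ (b : ℕ → ℝ) (f : ℝ → ℝ), (∀ n, 0 < b n) ∧ (∀ n, b (n + 1) ≤ b n / 1000) ∧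
      ContDiff ℝ (⊤ : ℕ∞) f ∧ ∀ x, f (dsum a x) = dsum b x := by
  choose φ hφ hφc hφd using fun n => exists_digit_fun ha n
  choose C hC0 hC using fun n => exists_deriv_bound (φ n) (hφ n) (hφc n) n
  set c : ℕ → ℝ := fun n => min (1 / 1000) (1 / C n) with hc
  have hc0 : ∀ n, 0 < c n := fun n => lt_min (by norm_num) (by have := hC0 n; positivity)
  have hc1 : ∀ n, c n ≤ 1 / 1000 := fun n => min_le_left _ _
  have hc2 : ∀ n, c n * C n ≤ 1 := fun n => by
    have h1 : c n ≤ 1 / C n := min_le_right _ _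
    rwa [le_div_iff₀ (hC0 n)] at h1
  set e : ℕ → ℝ := fun n => ∏ i ∈ Finset.range n, c i with he
  have he0 : ∀ n, 0 < e n := fun n => Finset.prod_pos fun i _ => hc0 i
  have he1 : ∀ n, e n ≤ (1 / 1000) ^ n := fun n => by
    have := Finset.prod_le_prod (s := Finset.range n) (f := c) (g := fun _ => (1 / 1000 : ℝ))
      (fun i _ => (hc0 i).le) (fun i _ => hc1 i)
    simpa using this
  have hes : ∀ n, e (n + 1) = e n * c n := fun n => Finset.prod_range_succ _ _
  refine ⟨fun n => e (n + 1), fun x => ∑' n, e (n + 1) * φ n x, fun n => he0 _, ?_, ?_, ?_⟩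
  · intro n
    simp only
    rw [hes (n + 1)]
    nlinarith [hc1 (n + 1), he0 (n + 1)]
  · refine contDiff_tsum_of_eventually (v := fun _ n => (1 / 1000 : ℝ) ^ n)
      (fun i => contDiff_const.mul (hφ i)) (fun k _ =>
        summable_geometric_of_lt_one (by norm_num) (by norm_num)) ?_
    intro k _
    rw [Nat.cofinite_eq_atTop]
    filter_upwards [eventually_ge_atTop k] with i hi x
    have h1 : iteratedFDeriv ℝ k (fun x => e (i + 1) * φ i x) x
        = e (i + 1) • iteratedFDeriv ℝ k (φ i) x :=
      iteratedFDeriv_const_smul_apply' (a := e (i + 1)) (f := φ i)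
        (((hφ i).of_le (by exact_mod_cast le_top)).contDiffAt)
    rw [h1, norm_smul, Real.norm_eq_abs, abs_of_pos (he0 _), hes]
    have h2 := hC i k hi x
    calc e i * c i * ‖iteratedFDeriv ℝ k (φ i) x‖ ≤ e i * c i * C i := by
          have := he0 i
          have := hc0 i
          gcongr
      _ ≤ e i := by nlinarith [hc2 i, he0 i]
      _ ≤ _ := he1 i
  · intro x
    simp only [dsum]
    congr 1
    ext n
    have := hφd n x
    simp only [dsum] at this
    rw [this]

lemma ratio_lt {a b : ℕ → ℝ} (ha : ∀ n, a n = (1 / 3) ^ n) (hb0 : ∀ n, 0 < b n)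
    (hb : ∀ n, b (n + 1) ≤ b n / 1000) (n m : ℕ) (h : n < m) :
    9 * (b m * a n) < b n * a m := by
  have ha0 : ∀ n, 0 < a n := fun n => by rw [ha]; positivity
  induction m, h using Nat.le_induction with
  | base =>
    have h1 : a (n + 1) = a n / 3 := by rw [ha, ha, pow_succ]; ring
    have h2 := mul_le_mul_of_nonneg_right (hb n) (ha0 n).le
    have h3 := mul_pos (hb0 n) (ha0 n)
    rw [Nat.succ_eq_add_one, h1]
    nlinarith
  | succ m _ ih =>
    have h1 : a (m + 1) = a m / 3 := by rw [ha, ha, pow_succ]; ring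
    have h2 := mul_le_mul_of_nonneg_right (hb m) (ha0 n).le
    have h3 := mul_pos (hb0 m) (ha0 n)
    have h4 := mul_pos (hb0 n) (ha0 m)
    rw [h1]
    nlinarith

lemma slope_lt {a b : ℕ → ℝ} (ha : ∀ n, a n = (1 / 3) ^ n) (ha' : Rapid a) (hb' : Rapid b)
    (hb : ∀ n, b (n + 1) ≤ b n / 1000) {n m : ℕ} (h : n < m) {x y u v : ℕ → Bool}
    (h1 : SplitAt n x y) (h2 : SplitAt m u v) :
    (dsum b v - dsum b u) * (dsum a y - dsum a x)
      < (dsum b y - dsum b x) * (dsum a v - dsum a u) := by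
  have r := ratio_lt ha hb'.1 hb n m h
  have A1 := dsum_diff ha' n x y h1
  have A2 := dsum_diff ha' m u v h2
  have B1 := dsum_diff hb' n x y h1
  have B2 := dsum_diff hb' m u v h2
  have p1 := ha'.1 n
  have p2 := ha'.1 m
  have p3 := hb'.1 n
  have p4 := hb'.1 m
  have k1 : (dsum b v - dsum b u) * (dsum a y - dsum a x) ≤ (3 / 2 * b m) * (3 / 2 * a n) :=
    mul_le_mul B2.2 A1.2 (by linarith [A1.1]) (by linarith)
  have k2 : (b n / 2) * (a m / 2) ≤ (dsum b y - dsum b x) * (dsum a v - dsum a u) :=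
    mul_le_mul B1.1 A2.1 (by linarith) (by linarith [B1.1])
  linarith

theorem stmt_14 :
    ∃ P : Set (ℝ × ℝ), Perfect P ∧ P.Nonempty ∧
      (∃ f : ℝ → ℝ, ContDiff ℝ (⊤ : ℕ∞) f ∧ P ⊆ {p : ℝ × ℝ | p.2 = f p.1}) ∧
      ∀ A : Set (ℝ × ℝ), NonSquiggly A → (P ∩ A).Countable := by
  obtain ⟨a, ha⟩ : ∃ a : ℕ → ℝ, ∀ n, a n = (1 / 3) ^ n := ⟨_, fun _ => rfl⟩
  have ha' : Rapid a := ⟨fun n => by rw [ha]; positivity, fun n => by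
    rw [ha, ha, pow_succ]; linarith⟩
  obtain ⟨b, f, hb0, hb, hf, hfd⟩ := exists_smooth ha'
  have hb' : Rapid b := ⟨hb0, fun n => by linarith [hb n, hb0 n]⟩
  set F : (ℕ → Bool) → ℝ × ℝ := fun x => (dsum a x, dsum b x) with hF
  have hFc : Continuous F := (dsum_continuous ha').prodMk (dsum_continuous hb')
  have hFi : Function.Injective F := fun x y h => dsum_injective ha' (congrArg Prod.fst h)
  refine ⟨range F, ⟨(isCompact_range hFc).isClosed, ?_⟩, range_nonempty F, ⟨f, hf, ?_⟩, ?_⟩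
  · rintro _ ⟨x, rfl⟩
    rw [accPt_iff_nhds]
    intro U hU
    have hU' : F ⁻¹' U ∈ 𝓝 x := hFc.continuousAt hU
    have ht : Tendsto (fun n => Function.update x n (!x n)) atTop (𝓝 x) := by
      rw [tendsto_pi_nhds]
      intro i
      refine tendsto_const_nhds.congr' ?_
      filter_upwards [eventually_gt_atTop i] with n hn
      rw [Function.update_of_ne hn.ne]
    obtain ⟨n, hn⟩ := (ht.eventually hU').exists
    refine ⟨F (Function.update x n (!x n)), ⟨hn, mem_range_self _⟩, fun h => ?_⟩
    have := congrFun (hFi h) n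
    simp at this
  · rintro _ ⟨x, rfl⟩
    exact (hfd x).symm
  · rintro A ⟨δ, hδ, hA⟩
    by_contra hcon
    have hB : ¬ (F ⁻¹' A).Countable := fun h => hcon ((h.image F).mono (by
      rintro _ ⟨⟨x, rfl⟩, hx⟩
      exact ⟨x, hx, rfl⟩))
    have hne : {x ∈ F ⁻¹' A | ∀ U ∈ 𝓝 x, ¬ (F ⁻¹' A ∩ U).Countable}.Nonempty := by
      rw [Set.nonempty_iff_ne_empty]
      intro h
      exact exists_condensation _ hB (by rw [h]; exact countable_empty)
    obtain ⟨x₀, -, hx₀⟩ := hne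
    have hδ2 : 0 < δ / 2 := ENNReal.half_pos hδ.ne'
    have hB2 := hx₀ (F ⁻¹' (Metric.eball (F x₀) (δ / 2)))
      (hFc.continuousAt (Metric.eball_mem_nhds _ hδ2))
    obtain ⟨y, hy, p, hp, q, hq, r, hr, n₁, n₂, n₃, h12, h23, syp, syq, sqr, spq⟩ :=
      exists_zigzag _ hB2
    have o1 := (dsum_diff ha' _ _ _ syp).1
    have o2 := (dsum_diff ha' _ _ _ spq).1
    have o3 := (dsum_diff ha' _ _ _ sqr).1
    have w1 := ha'.1 n₁
    have w2 := ha'.1 n₂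
    have w3 := ha'.1 n₃
    have hne : ∀ u v : ℕ → Bool, dsum a u ≠ dsum a v → F u ≠ F v :=
      fun u v h h' => h (congrArg Prod.fst h')
    refine hA (F p) hp.1 (F r) hr.1 (F y) hy.1 (F q) hq.1 ?_ ?_ ?_
    · have e1 : F p ≠ F r := hne _ _ (by linarith)
      have e2 : F p ≠ F y := hne _ _ (by linarith)
      have e3 : F p ≠ F q := hne _ _ (by linarith)
      have e4 : F r ≠ F y := hne _ _ (by linarith)
      have e5 : F r ≠ F q := hne _ _ (by linarith)
      have e6 : F y ≠ F q := hne _ _ (by linarith)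
      rw [Set.ncard_insert_of_notMem (by simp [e1, e2, e3]),
        Set.ncard_insert_of_notMem (by simp [e4, e5]), Set.ncard_pair e6]
    · have hsub : ({F p, F r, F y, F q} : Set (ℝ × ℝ)) ⊆ Metric.eball (F x₀) (δ / 2) := by
        rintro _ (rfl | rfl | rfl | rfl)
        exacts [hp.2, hr.2, hy.2, hq.2]
      refine (Metric.ediam_mono hsub).trans (Metric.ediam_eball_le.trans ?_)
      rw [ENNReal.mul_div_cancel (by norm_num) (by norm_num)]
    · have c1 := slope_lt ha ha' hb' hb (h12.trans h23) syp spq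
      have c2 := slope_lt ha ha' hb' hb h23 sqr spq
      have c3 := slope_lt ha ha' hb' hb h12 syq sqr
      apply mem_interior_of_cross
      · simp only [crossD, hF]; linarith
      · simp only [crossD, hF]; linarith
      · simp only [crossD, hF]; linarith
end

section
/- If E ⊆ ℝⁿ is bounded and infinite, then there exists an injective C^∞ map g : [0,1] → ℝⁿ whose image contains infinitely many points of E. -/
open Filter Topology

/-- strict monotonicity of the smooth transition on `[0,1]` (only the upper point matters) -/
lemma aux_strict {x y : ℝ} (hxy : x < y) (hy0 : 0 < y) (hy1 : y ≤ 1) :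
    Real.smoothTransition x < Real.smoothTransition y := by
  rcases le_or_gt x 0 with hx | hx
  · rw [Real.smoothTransition.zero_of_nonpos hx]
    exact Real.smoothTransition.pos_of_pos hy0
  · unfold Real.smoothTransition
    rw [div_lt_div_iff₀ (Real.smoothTransition.pos_denom x) (Real.smoothTransition.pos_denom y)]
    have h1 : expNegInvGlue x < expNegInvGlue y := by
      simp only [expNegInvGlue, not_le.2 hx, not_le.2 hy0, if_false]
      apply Real.exp_lt_exp.2
      apply neg_lt_neg
      exact (inv_lt_inv₀ hy0 hx).2 hxy
    have h2 : expNegInvGlue (1 - y) ≤ expNegInvGlue (1 - x) :=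
      expNegInvGlue.monotone (by linarith)
    have h3 : 0 < expNegInvGlue (1 - x) := expNegInvGlue.pos_of_pos (by linarith)
    have h4 := expNegInvGlue.pos_of_pos hx
    nlinarith [mul_le_mul_of_nonneg_left h2 h4.le, mul_lt_mul_of_pos_right h1 h3]

/-- the `k`-th step function -/
noncomputable def stepFn (k : ℕ) (t : ℝ) : ℝ :=
  Real.smoothTransition (2 ^ (k + 1) * t - 1) * Real.smoothTransition (2 - t)

lemma stepFn_contDiff (k : ℕ) : ContDiff ℝ (⊤ : ℕ∞) (stepFn k) := by
  unfold stepFn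
  apply ContDiff.mul
  · exact Real.smoothTransition.contDiff.comp
      ((contDiff_const.mul contDiff_id).sub contDiff_const)
  · exact Real.smoothTransition.contDiff.comp (contDiff_const.sub contDiff_id)

lemma stepFn_of_le_one (k : ℕ) {t : ℝ} (ht : t ≤ 1) :
    stepFn k t = Real.smoothTransition (2 ^ (k + 1) * t - 1) := by
  unfold stepFn
  rw [Real.smoothTransition.one_of_one_le (x := 2 - t) (by linarith), mul_one]

lemma stepFn_compact (k : ℕ) : HasCompactSupport (stepFn k) := by
  apply HasCompactSupport.intro (K := Set.Icc 0 2) isCompact_Icc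
  intro t ht
  unfold stepFn
  rcases lt_or_ge t 0 with h | h
  · rw [Real.smoothTransition.zero_of_nonpos, zero_mul]
    have : (0 : ℝ) < 2 ^ (k + 1) := by positivity
    nlinarith
  · have h2 : 2 < t := by
      by_contra hc
      exact ht ⟨h, not_lt.1 hc⟩
    rw [Real.smoothTransition.zero_of_nonpos (x := 2 - t) (by linarith), mul_zero]

lemma stepFn_bound (k : ℕ) : ∃ C : ℝ, 0 < C ∧ ∀ m ≤ k, ∀ t, ‖iteratedFDeriv ℝ m (stepFn k) t‖ ≤ C := by
  have h : ∀ m : ℕ, ∃ C : ℝ, ∀ t, ‖iteratedFDeriv ℝ m (stepFn k) t‖ ≤ C := fun m =>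
    ((stepFn_compact k).iteratedFDeriv (𝕜 := ℝ) m).exists_bound_of_continuous
      ((stepFn_contDiff k).continuous_iteratedFDeriv (by exact_mod_cast le_top))
  choose C hC using h
  refine ⟨∑ m ∈ Finset.range (k + 1), |C m| + 1, by positivity, fun m hm t => ?_⟩
  have := Finset.single_le_sum (f := fun m => |C m|) (fun i _ => abs_nonneg _)
    (Finset.mem_range.2 (Nat.lt_succ_of_le hm))
  have h2 := hC m t
  have h3 := le_abs_self (C m)
  linarith

lemma core {F : Type*} [NormedAddCommGroup F] [NormedSpace ℝ F] [CompleteSpace F]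
    (x : ℕ → F) (p : F) (hx : Tendsto x atTop (𝓝 p)) (L : F →L[ℝ] ℝ)
    (hL : StrictAnti fun k => L (x k)) :
    ∃ g : ℝ → F, ContDiff ℝ (⊤ : ℕ∞) g ∧ Set.InjOn g (Set.Icc 0 1) ∧
      ∃ ψ : ℕ → ℕ, StrictMono ψ ∧ ∀ j, x (ψ j) ∈ g '' Set.Icc 0 1 := by
  choose C hC0 hC using stepFn_bound
  set η : ℕ → ℝ := fun k => (1 / 2) ^ k / C k with hη
  have hηpos : ∀ k, 0 < η k := fun k => div_pos (by positivity) (hC0 k)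
  obtain ⟨ψ, hψ, hψ2⟩ := extraction_forall_of_eventually
    (P := fun n k => ∀ j ∈ Finset.range (n + 1), dist (x k) p < η j / 2) (fun n => by
      rw [Filter.eventually_all_finset]
      intro j _
      exact (Metric.tendsto_nhds.1 hx) _ (half_pos (hηpos j)))
  set y : ℕ → F := fun k => x (ψ k) with hy
  have hyp : Tendsto y atTop (𝓝 p) := hx.comp hψ.tendsto_atTop
  have hyL : StrictAnti fun k => L (y k) := fun a b hab => hL (hψ hab)
  set v : ℕ → F := fun k => y k - y (k + 1) with hv
  have hvn : ∀ k, ‖v k‖ ≤ η k := by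
    intro k
    have h1 := hψ2 k k (by simp)
    have h2 := hψ2 (k + 1) k (by simp)
    have h3 := dist_triangle_right (y k) (y (k + 1)) p
    rw [hv]; simp only [← dist_eq_norm]
    simp only [hy] at *
    linarith
  set f : ℕ → ℝ → F := fun k t => stepFn k t • v k with hf
  have hfb : ∀ m k, m ≤ k → ∀ t, ‖iteratedFDeriv ℝ m (f k) t‖ ≤ (1 / 2) ^ k := by
    intro m k hmk t
    have e : f k = (ContinuousLinearMap.toSpanSingleton ℝ (v k)) ∘ stepFn k := by
      ext t; simp [hf]
    rw [e]
    refine (ContinuousLinearMap.norm_iteratedFDeriv_comp_left _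
      (stepFn_contDiff k).contDiffAt (by exact_mod_cast le_top)).trans ?_
    rw [ContinuousLinearMap.norm_toSpanSingleton]
    calc ‖v k‖ * ‖iteratedFDeriv ℝ m (stepFn k) t‖ ≤ η k * C k :=
          mul_le_mul (hvn k) (hC k m hmk t) (norm_nonneg _) (hηpos k).le
      _ = _ := by rw [hη]; exact div_mul_cancel₀ _ (hC0 k).ne'
  have hgeo : Summable fun k : ℕ => ((1 : ℝ) / 2) ^ k := summable_geometric_two
  have hsum : ∀ t, Summable fun k => f k t := fun t =>
    Summable.of_norm_bounded hgeo fun k => by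
      simpa [norm_iteratedFDeriv_zero] using hfb 0 k (Nat.zero_le _) t
  have hsm : ContDiff ℝ (⊤ : ℕ∞) fun t => ∑' k, f k t := by
    apply contDiff_tsum_of_eventually (v := fun _ k => ((1 : ℝ) / 2) ^ k)
    · exact fun k => (stepFn_contDiff k).smul contDiff_const
    · exact fun _ _ => hgeo
    · intro m _
      rw [Nat.cofinite_eq_atTop]
      filter_upwards [eventually_ge_atTop m] with k hk t using hfb m k hk t
  have hmono : ∀ s t : ℝ, 0 ≤ s → s < t → t ≤ 1 →
      L (∑' k, f k s) < L (∑' k, f k t) := by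
    intro s t hs hst ht
    rw [L.map_tsum (hsum s), L.map_tsum (hsum t)]
    obtain ⟨k, hk1, hk2⟩ := exists_nat_pow_near_of_lt_one (y := (1 / 2 : ℝ))
      (hs.trans_lt hst) ht (by norm_num) (by norm_num)
    have hLv : ∀ k, 0 < L (v k) := fun k => by
      have := hyL (Nat.lt_succ_self k)
      simp only [hv, map_sub]
      simpa using this
    have e : ∀ k t, L (f k t) = stepFn k t * L (v k) := fun k t => by simp [hf]
    refine Summable.tsum_lt_tsum (i := k) (fun j => ?_) ?_
      ((hsum s).mapL L) ((hsum t).mapL L)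
    · rw [e, e, stepFn_of_le_one _ ht, stepFn_of_le_one _ (hst.le.trans ht)]
      refine mul_le_mul_of_nonneg_right (Real.smoothTransition.monotone ?_) (hLv j).le
      gcongr
    · rw [e, e, stepFn_of_le_one _ ht, stepFn_of_le_one _ (hst.le.trans ht)]
      refine mul_lt_mul_of_pos_right (aux_strict ?_ ?_ ?_) (hLv k)
      · gcongr
      · have : (2 : ℝ) ^ (k + 1) * (1 / 2) ^ (k + 1) = 1 := by
          rw [← mul_pow]; norm_num
        have h2 : (2 : ℝ) ^ (k + 1) * (1 / 2) ^ (k + 1) < 2 ^ (k + 1) * t := by gcongr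
        linarith
      · have : (2 : ℝ) ^ (k + 1) * (1 / 2) ^ k = 2 := by
          rw [pow_succ, mul_right_comm, ← mul_pow]; norm_num
        have h2 : (2 : ℝ) ^ (k + 1) * t ≤ 2 ^ (k + 1) * (1 / 2) ^ k := by gcongr
        linarith
  have hval : ∀ j : ℕ, ∑' k, f k ((1 / 2) ^ j) = y j - p := by
    intro j
    have hle : ((1 : ℝ) / 2) ^ j ≤ 1 := pow_le_one₀ (by norm_num) (by norm_num)
    have h0 : ∀ k, k < j → f k ((1 / 2) ^ j) = 0 := by
      intro k hk
      simp only [hf]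
      rw [stepFn_of_le_one _ hle, Real.smoothTransition.zero_of_nonpos, zero_smul]
      have : (2 : ℝ) ^ (k + 1) ≤ 2 ^ j := pow_le_pow_right₀ (by norm_num) hk
      have h3 : (2 : ℝ) ^ (k + 1) * (1 / 2) ^ j ≤ 2 ^ j * (1 / 2) ^ j := by gcongr
      rw [← mul_pow] at h3
      norm_num at h3 ⊢
      linarith
    have h1 : ∀ k, j ≤ k → f k ((1 / 2) ^ j) = v k := by
      intro k hk
      simp only [hf]
      rw [stepFn_of_le_one _ hle, Real.smoothTransition.one_of_one_le, one_smul]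
      have : (2 : ℝ) ^ (j + 1) ≤ 2 ^ (k + 1) := pow_le_pow_right₀ (by norm_num) (by omega)
      have h3 : (2 : ℝ) ^ (j + 1) * (1 / 2) ^ j ≤ 2 ^ (k + 1) * (1 / 2) ^ j := by gcongr
      have h4 : (2 : ℝ) ^ (j + 1) * (1 / 2) ^ j = 2 := by
        rw [pow_succ, mul_right_comm, ← mul_pow]; norm_num
      linarith
    have hpart : ∀ N, j ≤ N → ∑ k ∈ Finset.range N, f k ((1 / 2) ^ j) = y j - y N := by
      intro N hN
      induction N, hN using Nat.le_induction with
      | base =>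
        rw [sub_self]
        exact Finset.sum_eq_zero fun k hk => h0 k (Finset.mem_range.1 hk)
      | succ N hN ih =>
        rw [Finset.sum_range_succ, ih, h1 N hN]
        simp only [hv]; abel
    refine tendsto_nhds_unique (hsum ((1 / 2) ^ j)).hasSum.tendsto_sum_nat ?_
    refine (tendsto_const_nhds.sub hyp).congr' ?_
    filter_upwards [eventually_ge_atTop j] with N hN using (hpart N hN).symm
  refine ⟨fun t => p + ∑' k, f k t, contDiff_const.add hsm, ?_, ψ, hψ, ?_⟩
  · intro s hs t ht hst
    have hst' : ∑' k, f k s = ∑' k, f k t := add_left_cancel hst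
    by_contra hne
    rcases lt_or_gt_of_ne hne with h | h
    · exact absurd (congrArg L hst') (hmono s t hs.1 h ht.2).ne
    · exact absurd (congrArg L hst') (hmono t s ht.1 h hs.2).ne'
  · intro j
    refine ⟨(1 / 2) ^ j, ⟨by positivity, pow_le_one₀ (by norm_num) (by norm_num)⟩, ?_⟩
    simp only [hval j, hy]
    abel

theorem stmt_19 {n : ℕ} (E : Set (EuclideanSpace ℝ (Fin n)))
    (hbdd : Bornology.IsBounded E) (hinf : E.Infinite) :
    ∃ g : ℝ → EuclideanSpace ℝ (Fin n), ContDiff ℝ (⊤ : ℕ∞) g ∧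
      Set.InjOn g (Set.Icc 0 1) ∧ (E ∩ g '' Set.Icc 0 1).Infinite := by
  -- some coordinate takes infinitely many values on `E`
  obtain ⟨i, hi⟩ : ∃ i : Fin n, ((fun x : EuclideanSpace ℝ (Fin n) => x i) '' E).Infinite := by
    by_contra hcon
    push Not at hcon
    have hfin := Set.Finite.pi' hcon
    apply hinf
    refine Set.Finite.of_finite_image (f := fun x : EuclideanSpace ℝ (Fin n) => fun i => x i)
      (hfin.subset ?_) ?_
    · rintro _ ⟨x, hx, rfl⟩ i
      exact ⟨x, hx, rfl⟩
    · intro a _ b _ hab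
      ext i
      exact congrFun hab i
  let a := hi.natEmbedding
  have ha : ∀ k, ∃ x ∈ E, x i = (a k : ℝ) := fun k => (a k).2
  choose x hxE hxa using ha
  have hxinj : ∀ k l, x k i = x l i → k = l := fun k l h => by
    rw [hxa, hxa] at h
    exact a.injective (Subtype.ext h)
  obtain ⟨p, -, φ, hφ, hlim⟩ := tendsto_subseq_of_bounded hbdd hxE
  obtain ⟨θ, hθ⟩ := exists_increasing_or_nonincreasing_subseq (· < ·)
    (fun k => (x (φ k)) i)
  set z : ℕ → EuclideanSpace ℝ (Fin n) := fun k => x (φ (θ k)) with hz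
  have hzlim : Tendsto z atTop (𝓝 p) := hlim.comp θ.strictMono.tendsto_atTop
  have hzinj : ∀ k l, z k i = z l i → k = l := fun k l h =>
    θ.injective (hφ.injective (hxinj _ _ h))
  obtain ⟨L, hL⟩ : ∃ L : EuclideanSpace ℝ (Fin n) →L[ℝ] ℝ, StrictAnti fun k => L (z k) := by
    rcases hθ with h | h
    · refine ⟨-(EuclideanSpace.proj i), fun k l hkl => ?_⟩
      simpa using h k l hkl
    · refine ⟨EuclideanSpace.proj i, fun k l hkl => ?_⟩
      have h1 : z l i ≤ z k i := not_lt.1 (h k l hkl)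
      have h2 : z l i ≠ z k i := fun e => hkl.ne' (hzinj _ _ e)
      simpa using lt_of_le_of_ne h1 h2
  obtain ⟨g, hg, hgi, ψ, hψ, hmem⟩ := core z p hzlim L hL
  refine ⟨g, hg, hgi, ?_⟩
  refine Set.infinite_of_injective_forall_mem (f := fun j => z (ψ j)) ?_
    (fun j => ⟨hxE _, hmem j⟩)
  intro j k h
  exact hψ.injective (hzinj _ _ (congrArg (fun w : EuclideanSpace ℝ (Fin n) => w i) h))
end
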